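/- arXiv:1212.0718 — 3 statements merged into one kernel-verified Lean document; each statement's English description precedes it below -/
import Mathlib

section
/- Let K be a field of characteristic zero, let n ≥ 512 be an integer, and set δ(n) = (3·(6n)^{1/3} + 4.3)/7. Then for every integer m ≥ 1 there exists a nonzero polynomial G in 4n variables over K such that for every tuple (v_1,…,v_n) of nonzero vectors in K^4 with G(v_1,…,v_n) ≠ 0, the ideal I = ⋂_{j=1}^n m_{v_j} satisfies α(I^{(m)}) ≥ m·δ(n). Moreover δ(n) ≥ 0.7787·n^{1/3} + 0.6142 for all n ≥ 512; hence the Waldschmidt constant of the ideal of n ≥ 512 points in general position in P^3 satisfies γ(n) ≥ δ(n) ≥ 0.7787·n^{1/3} + 0.6142. -/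
open MvPolynomial Filter

noncomputable section

/-- The ideal of a point of `ℙ³` represented by a nonzero vector `v ∈ K⁴`:
the ideal generated by all linear forms vanishing at `v`. -/
def pointIdeal (K : Type) [Field K] (v : Fin 4 → K) : Ideal (MvPolynomial (Fin 4) K) :=
  Ideal.span {f | f.IsHomogeneous 1 ∧ eval v f = 0}

/-- `α(J)`: the least `t ≥ 0` such that the degree-`t` homogeneous component of the
homogeneous ideal `J` is nonzero. -/
def alphaDeg {K : Type} [Field K] {σ : Type} (J : Ideal (MvPolynomial σ K)) : ℕ :=
  sInf {t | ∃ f ∈ J, f ≠ 0 ∧ f.IsHomogeneous t}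

/-- `δ(n) = (3·(6n)^(1/3) + 4.3)/7`. -/
noncomputable def deltaBound (n : ℕ) : ℝ :=
  (3 * (6 * (n : ℝ)) ^ ((1 : ℝ) / 3) + 4.3) / 7

namespace MvPolynomial

section Translate

variable {σ R : Type*} [CommRing R]

/-- The Taylor expansion of a polynomial at the point `a`. -/
def taylorAt (a : σ → R) : MvPolynomial σ R →ₐ[R] MvPolynomial σ R :=
  aeval fun i => C (a i) + X i

@[simp]
theorem taylorAt_X (a : σ → R) (i : σ) : taylorAt a (X i) = C (a i) + X i := by
  simp [taylorAt]

@[simp]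
theorem taylorAt_C (a : σ → R) (r : R) : taylorAt a (C r) = C r := by
  simp [taylorAt, algebraMap_eq]

theorem constantCoeff_taylorAt (a : σ → R) (p : MvPolynomial σ R) :
    constantCoeff (taylorAt a p) = eval a p := by
  induction p using MvPolynomial.induction_on with
  | C c => simp
  | add p q hp hq => simp [hp, hq]
  | mul_X p i hp => simp [hp]

theorem taylorAt_injective (a : σ → R) : Function.Injective (taylorAt a) := by
  have : (taylorAt (-a)).comp (taylorAt a) = AlgHom.id R (MvPolynomial σ R) := by
    ext i; simp
  exact Function.LeftInverse.injective (g := taylorAt (-a)) fun p => DFunLike.congr_fun this p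

theorem mem_pow_idealOfVars_iff_le_order (m : ℕ) (p : MvPolynomial σ R) :
    p ∈ idealOfVars σ R ^ m ↔ (m : ℕ∞) ≤ (p : MvPowerSeries σ R).order := by
  rw [mem_pow_idealOfVars_iff']
  constructor
  · intro h
    exact MvPowerSeries.nat_le_order fun d hd => by simpa using h d hd
  · intro h d hd
    rw [← coeff_coe]
    exact MvPowerSeries.coeff_of_lt_order (lt_of_lt_of_le (by exact_mod_cast hd) h)

end Translate

section Restrict

variable {R : Type*} [CommRing R] {r : ℕ}

/-- Restriction of a polynomial to the hyperplane on which the first coordinate equals `s`. -/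
def restrictFirst (s : R) : MvPolynomial (Fin (r + 1)) R →ₐ[R] MvPolynomial (Fin r) R :=
  aeval (Fin.cons (C s) X : Fin (r + 1) → MvPolynomial (Fin r) R)

@[simp]
theorem restrictFirst_X_zero (s : R) : restrictFirst s (X (0 : Fin (r + 1))) = C s := by
  simp [restrictFirst]

@[simp]
theorem restrictFirst_X_succ (s : R) (i : Fin r) : restrictFirst s (X i.succ) = X i := by
  simp [restrictFirst]

@[simp]
theorem restrictFirst_C (s c : R) :
    restrictFirst s (C c : MvPolynomial (Fin (r + 1)) R) = C c := by
  simp [restrictFirst, algebraMap_eq]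

theorem eval_restrictFirst (s : R) (a : Fin r → R) (p : MvPolynomial (Fin (r + 1)) R) :
    eval a (restrictFirst s p) = eval (Fin.cons s a : Fin (r + 1) → R) p := by
  induction p using MvPolynomial.induction_on with
  | C c => simp
  | add p q hp hq => simp [hp, hq]
  | mul_X p i hp =>
    rw [map_mul, map_mul, map_mul, hp]
    refine Fin.cases ?_ (fun j => ?_) i <;> simp

theorem restrictFirst_taylorAt (s : R) (a : Fin r → R) (p : MvPolynomial (Fin (r + 1)) R) :
    restrictFirst 0 (taylorAt (Fin.cons s a) p) = taylorAt a (restrictFirst s p) := by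
  have : (restrictFirst 0).comp (taylorAt (Fin.cons s a : Fin (r + 1) → R)) =
      (taylorAt a).comp (restrictFirst s) := by
    ext i : 1
    refine Fin.cases ?_ (fun j => ?_) i <;> simp
  exact DFunLike.congr_fun this p

theorem taylorAt_restrictFirst_mem {s : R} {a : Fin r → R} {m : ℕ}
    {p : MvPolynomial (Fin (r + 1)) R}
    (h : taylorAt (Fin.cons s a) p ∈ idealOfVars (Fin (r + 1)) R ^ m) :
    taylorAt a (restrictFirst s p) ∈ idealOfVars (Fin r) R ^ m := by
  rw [← restrictFirst_taylorAt]
  have hle : (idealOfVars (Fin (r + 1)) R).map (restrictFirst (0 : R)) ≤ idealOfVars (Fin r) R := by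
    rw [Ideal.map_span, Ideal.span_le]
    rintro _ ⟨_, ⟨i, rfl⟩, rfl⟩
    refine Fin.cases ?_ (fun j => ?_) i
    · simp
    · simpa using Ideal.subset_span (Set.mem_range_self j)
  have := Ideal.mem_map_of_mem (restrictFirst (0 : R)) h
  rw [Ideal.map_pow] at this
  exact Ideal.pow_right_mono hle m this

theorem totalDegree_restrictFirst_le (s : R) (p : MvPolynomial (Fin (r + 1)) R) :
    (restrictFirst s p).totalDegree ≤ p.totalDegree := by
  rw [restrictFirst, aeval_def, eval₂_eq']
  refine totalDegree_finsetSum_le fun d hd => ?_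
  refine (totalDegree_mul _ _).trans ?_
  rw [algebraMap_eq, totalDegree_C, zero_add]
  refine (totalDegree_finsetProd _ _).trans ((Finset.sum_le_sum (g := fun i => d i)
    fun i _ => ?_).trans ?_)
  · refine (totalDegree_pow _ _).trans ?_
    refine (Nat.mul_le_mul_left (d i) ?_).trans_eq (mul_one _)
    refine Fin.cases ?_ (fun j => ?_) i
    · simp
    · simpa [X] using totalDegree_monomial_le (Finsupp.single j 1) (1 : R)
  · have := le_totalDegree hd
    rwa [Finsupp.sum_fintype _ _ (by simp)] at this

theorem eval_finSuccEquiv (s : R) (p : MvPolynomial (Fin (r + 1)) R) :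
    (finSuccEquiv R r p).eval (C s) = restrictFirst s p := by
  induction p using MvPolynomial.induction_on with
  | C c => simp [finSuccEquiv_apply]
  | add p q hp hq => simp [hp, hq]
  | mul_X p i hp =>
    rw [map_mul, map_mul, Polynomial.eval_mul, hp]
    refine Fin.cases ?_ (fun j => ?_) i <;> simp [finSuccEquiv_apply]

end Restrict

section Grid

variable {K : Type*} [Field K] {r : ℕ}

theorem prod_dvd_of_restrictFirst_eq_zero {S : Finset K} {p : MvPolynomial (Fin (r + 1)) K}
    (h : ∀ s ∈ S, restrictFirst s p = 0) : ∏ s ∈ S, (X 0 - C s) ∣ p := by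
  have hX (s : K) : finSuccEquiv K r (X 0 - C s) = Polynomial.X - Polynomial.C (C s) := by
    simp [finSuccEquiv_apply]
  rw [← map_dvd_iff (finSuccEquiv K r), map_prod]
  refine Finset.prod_dvd_of_coprime (fun s _ t _ hst => ?_) fun s hs => ?_
  · simp only [Function.onFun, hX]
    refine Polynomial.isCoprime_X_sub_C_of_isUnit_sub ?_
    rw [← C_sub]
    exact (sub_ne_zero_of_ne hst).isUnit.map C
  · rw [hX, Polynomial.dvd_iff_isRoot, Polynomial.IsRoot.def, eval_finSuccEquiv, h s hs]

theorem totalDegree_X_sub_C {σ : Type*} (i : σ) (s : K) :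
    (X i - C s : MvPolynomial σ K).totalDegree = 1 := by
  rw [sub_eq_add_neg, ← C_neg, totalDegree_add_eq_left_of_totalDegree_lt] <;> simp

theorem X_sub_C_ne_zero {σ : Type*} (i : σ) (s : K) : (X i - C s : MvPolynomial σ K) ≠ 0 := by
  intro h
  simpa [h] using totalDegree_X_sub_C i s

theorem totalDegree_prod_X_sub_C {σ : Type*} (i : σ) (S : Finset K) :
    (∏ s ∈ S, (X i - C s : MvPolynomial σ K)).totalDegree = S.card := by
  classical
  induction S using Finset.induction_on with
  | empty => simp
  | insert s S hs ih =>
    rw [Finset.prod_insert hs, totalDegree_mul_of_isDomain (X_sub_C_ne_zero i s)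
      (Finset.prod_ne_zero_iff.2 fun t _ => X_sub_C_ne_zero i t), ih, totalDegree_X_sub_C,
      Finset.card_insert_of_notMem hs, add_comm]

theorem order_taylorAt_prod_X_sub_C {σ : Type*} (i : σ) {S : Finset K} {a : σ → K}
    (ha : a i ∈ S) :
    (taylorAt a (∏ s ∈ S, (X i - C s)) : MvPowerSeries σ K).order = 1 := by
  classical
  rw [← Finset.mul_prod_erase S _ ha, map_mul, coe_mul, MvPowerSeries.order_mul]
  have h1 : taylorAt a (X i - C (a i)) = X i := by simp
  have h2 : (taylorAt a (∏ s ∈ S.erase (a i), (X i - C s)) : MvPowerSeries σ K).order = 0 := by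
    by_contra h
    rw [← ne_eq, MvPowerSeries.order_ne_zero_iff_constCoeff_eq_zero,
      ← MvPowerSeries.coeff_zero_eq_constantCoeff_apply, coeff_coe, ← constantCoeff_eq,
      constantCoeff_taylorAt, map_prod, Finset.prod_eq_zero_iff] at h
    obtain ⟨s, hs, h⟩ := h
    simp only [map_sub, eval_X, eval_C, sub_eq_zero] at h
    simp [h] at hs
  rw [h1, h2, coe_X, MvPowerSeries.X, MvPowerSeries.order_monomial_of_ne_zero one_ne_zero]
  simp

/-- A polynomial of total degree less than `m * #S` vanishing to order `m` at every point of the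
grid `S ^ r` is zero. -/
theorem eq_zero_of_taylorAt_mem_of_grid (S : Finset K) (m : ℕ) (p : MvPolynomial (Fin r) K)
    (hdeg : p.totalDegree < m * S.card)
    (hp : ∀ a : Fin r → K, (∀ i, a i ∈ S) → taylorAt a p ∈ idealOfVars (Fin r) K ^ m) :
    p = 0 := by
  induction r generalizing m with
  | zero =>
    have h := (mem_pow_idealOfVars_iff' _ _).1 (hp 0 fun i => i.elim0)
    refine taylorAt_injective 0 ?_
    ext d
    rw [h d, map_zero, coeff_zero]
    rw [Subsingleton.elim d 0, map_zero]
    exact Nat.pos_of_mul_pos_right (Nat.zero_lt_of_lt hdeg)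
  | succ r ih =>
    induction m generalizing p with
    | zero => simp at hdeg
    | succ m ihm =>
      by_contra hp0
      obtain ⟨q, rfl⟩ := prod_dvd_of_restrictFirst_eq_zero (S := S) (p := p) fun s hs =>
        ih (m + 1) _ ((totalDegree_restrictFirst_le s p).trans_lt hdeg) fun a ha =>
          taylorAt_restrictFirst_mem (hp _ (Fin.cases hs ha))
      have hq0 : q ≠ 0 := right_ne_zero_of_mul hp0
      refine hq0 (ihm q ?_ fun a ha => ?_)
      · rw [totalDegree_mul_of_isDomain (left_ne_zero_of_mul hp0) hq0,
          totalDegree_prod_X_sub_C, add_mul, one_mul] at hdeg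
        omega
      · have := hp a ha
        rw [mem_pow_idealOfVars_iff_le_order, map_mul, coe_mul, MvPowerSeries.order_mul,
          order_taylorAt_prod_X_sub_C 0 (ha 0), add_comm m, Nat.cast_add, Nat.cast_one] at this
        rw [mem_pow_idealOfVars_iff_le_order]
        exact (ENat.add_le_add_iff_left ENat.one_ne_top).1 this

theorem IsHomogeneous.eval_smul {σ R : Type*} [CommSemiring R] {f : MvPolynomial σ R} {t : ℕ}
    (hf : f.IsHomogeneous t) (c : R) (y : σ → R) : eval (c • y) f = c ^ t * eval y f := by
  rw [eval_eq, eval_eq, Finset.mul_sum]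
  refine Finset.sum_congr rfl fun d hd => ?_
  simp only [Pi.smul_apply, smul_eq_mul, mul_pow, Finset.prod_mul_distrib,
    Finset.prod_pow_eq_pow_sum]
  rw [hf.degree_eq_sum_deg_support hd]
  ring

/-- A form of degree less than `m * #S` in `r + 1` variables vanishing to order `m` at every point
`(1, a)` with `a` in the grid `S ^ r` is zero. -/
theorem IsHomogeneous.eq_zero_of_taylorAt_mem_of_grid [Infinite K] {S : Finset K} {m t : ℕ}
    {f : MvPolynomial (Fin (r + 1)) K} (hf : f.IsHomogeneous t) (ht : t < m * S.card)
    (h : ∀ a : Fin r → K, (∀ i, a i ∈ S) →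
      taylorAt (Fin.cons 1 a) f ∈ idealOfVars (Fin (r + 1)) K ^ m) :
    f = 0 := by
  have h0 : restrictFirst 1 f = 0 :=
    MvPolynomial.eq_zero_of_taylorAt_mem_of_grid S m _
      (((totalDegree_restrictFirst_le 1 f).trans hf.totalDegree_le).trans_lt ht)
      fun a ha => taylorAt_restrictFirst_mem (h a ha)
  have hX : X 0 * f = 0 := by
    refine MvPolynomial.funext fun y => ?_
    rw [map_mul, eval_X, map_zero]
    rcases eq_or_ne (y 0) 0 with hy | hy
    · rw [hy, zero_mul]
    have hy' : y = y 0 • (Fin.cons 1 fun i => (y 0)⁻¹ * y i.succ : Fin (r + 1) → K) := by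
      ext i
      refine Fin.cases ?_ (fun j => ?_) i <;> simp [hy]
    rw [hy', hf.eval_smul, ← eval_restrictFirst, h0, map_zero, mul_zero, mul_zero]
  exact (mul_eq_zero.1 hX).resolve_left (X_ne_zero 0)

end Grid

section Generic

variable {σ τ J K : Type*} [Field K]

theorem exists_eval_ne_zero_and_mulVec_injective {κ ι : Type*} [Finite κ] [Fintype ι]
    (M : Matrix κ ι (MvPolynomial τ K)) (x₀ : τ → K)
    (h : ∀ c, (M.map (eval x₀)).mulVec c = 0 → c = 0) :
    ∃ G : MvPolynomial τ K, eval x₀ G ≠ 0 ∧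
      ∀ x, eval x G ≠ 0 → ∀ c, (M.map (eval x)).mulVec c = 0 → c = 0 := by
  classical
  have := Fintype.ofFinite κ
  obtain ⟨l, hl⟩ := LinearMap.exists_leftInverse_of_injective (M.map (eval x₀)).mulVecLin
    (LinearMap.ker_eq_bot'.2 h)
  let L := LinearMap.toMatrix' l
  have hL : L * M.map (eval x₀) = 1 := by
    rw [← LinearMap.toMatrix'_toLin' (M.map (eval x₀)), Matrix.toLin'_apply',
      ← LinearMap.toMatrix'_comp, hl, LinearMap.toMatrix'_id]
  have key (x : τ → K) :
      eval x (L.map (C : K →+* MvPolynomial τ K) * M).det = (L * M.map (eval x)).det := by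
    rw [RingHom.map_det, RingHom.mapMatrix_apply, Matrix.map_mul, Matrix.map_map]
    congr 2
    ext; simp
  refine ⟨(L.map (C : K →+* MvPolynomial τ K) * M).det, by rw [key, hL]; simp, fun x hx c hc => ?_⟩
  rw [key] at hx
  refine Matrix.eq_zero_of_mulVec_eq_zero hx ?_
  rw [← Matrix.mulVec_mulVec, hc, Matrix.mulVec_zero]

theorem map_taylorAt {R S : Type*} [CommRing R] [CommRing S] (φ : R →+* S) (a : σ → R)
    (p : MvPolynomial σ R) : map φ (taylorAt a p) = taylorAt (φ ∘ a) (map φ p) := by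
  induction p using MvPolynomial.induction_on with
  | C c => simp
  | add p q hp hq => simp [hp, hq]
  | mul_X p i hp => simp [hp]

/-- If no nonzero form of degree `t` vanishes to order `m` at the points of one configuration, then
the same holds for all configurations off a hypersurface not containing the given one. -/
theorem exists_eval_ne_zero_and_forall_isHomogeneous_eq_zero [Finite σ] [Finite J] (m t : ℕ)
    (v₀ : J → σ → K)
    (h : ∀ f : MvPolynomial σ K, f.IsHomogeneous t →
      (∀ j, taylorAt (v₀ j) f ∈ idealOfVars σ K ^ m) → f = 0) :
    ∃ G : MvPolynomial (J × σ) K, eval (fun p => v₀ p.1 p.2) G ≠ 0 ∧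
      ∀ v : J → σ → K, eval (fun p => v p.1 p.2) G ≠ 0 →
        ∀ f : MvPolynomial σ K, f.IsHomogeneous t →
          (∀ j, taylorAt (v j) f ∈ idealOfVars σ K ^ m) → f = 0 := by
  classical
  have := (Finsupp.finite_of_degree_eq (σ := σ) t).fintype
  have := (Finsupp.finite_of_degree_lt (σ := σ) m).to_subtype
  let M : Matrix (J × {d : σ →₀ ℕ | d.degree < m}) {b : σ →₀ ℕ | b.degree = t}
      (MvPolynomial (J × σ) K) :=
    .of fun jd b => coeff jd.2.1 (taylorAt (fun i => X (jd.1, i)) (monomial b.1 1))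
  let form (c : {b : σ →₀ ℕ | b.degree = t} → K) : MvPolynomial σ K := ∑ b, monomial b.1 (c b)
  have hM (v : J → σ → K) (c) (j d) :
      (M.map (eval fun p => v p.1 p.2)).mulVec c (j, d) =
        coeff d.1 (taylorAt (v j) (form c)) := by
    simp only [Matrix.mulVec, dotProduct, Matrix.map_apply, Matrix.of_apply, M, form, map_sum,
      coeff_sum]
    refine Finset.sum_congr rfl fun b _ => ?_
    have hb : monomial b.1 (c b) = c b • monomial b.1 (1 : K) := by simp [smul_monomial]
    rw [← coeff_map, map_taylorAt, hb, map_smul, coeff_smul, smul_eq_mul, mul_comm, map_monomial,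
      map_one]
    congr 3
    ext i
    simp
  have hform_hom (c) : (form c).IsHomogeneous t :=
    IsHomogeneous.sum _ _ _ fun b _ => isHomogeneous_monomial _ b.2
  have hform_coeff (c b) : coeff b.1 (form c) = c b := by
    simp [form, coeff_sum, coeff_monomial, Subtype.coe_inj]
  obtain ⟨G, hG₀, hG⟩ := exists_eval_ne_zero_and_mulVec_injective M (fun p => v₀ p.1 p.2)
    fun c hc => by
      have := h (form c) (hform_hom c) fun j => (mem_pow_idealOfVars_iff' _ _).2 fun d hd => by
        rw [← hM v₀ c j ⟨d, hd⟩, hc, Pi.zero_apply]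
      ext b
      rw [← hform_coeff c b, this, coeff_zero, Pi.zero_apply]
  refine ⟨G, hG₀, fun v hv f hf hfv => ?_⟩
  have hform_f : form (fun b => coeff b.1 f) = f := by
    ext d
    by_cases hd : d.degree = t
    · exact hform_coeff _ ⟨d, hd⟩
    · rw [(hform_hom _).coeff_eq_zero hd, hf.coeff_eq_zero hd]
  have hc := hG (fun p => v p.1 p.2) hv (fun b => coeff b.1 f) <| by
    ext ⟨j, d⟩
    rw [hM, hform_f, Pi.zero_apply]
    exact (mem_pow_idealOfVars_iff' _ _).1 (hfv j) d.1 d.2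
  rw [← hform_f, hc]
  simp [form]

end Generic

end MvPolynomial

section PointIdeal

variable {K : Type} [Field K]

theorem taylorAt_mem_of_mem_pointIdeal_pow {v : Fin 4 → K} {m : ℕ}
    {f : MvPolynomial (Fin 4) K} (hf : f ∈ pointIdeal K v ^ m) :
    taylorAt v f ∈ idealOfVars (Fin 4) K ^ m := by
  have hle : (pointIdeal K v).map (taylorAt v) ≤ idealOfVars (Fin 4) K := by
    rw [pointIdeal, Ideal.map_span, Ideal.span_le]
    rintro _ ⟨g, ⟨-, hg⟩, rfl⟩
    rw [SetLike.mem_coe, ← pow_one (idealOfVars _ _), mem_pow_idealOfVars_iff']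
    intro d hd
    obtain rfl : d = 0 := (Finsupp.degree_eq_zero_iff d).1 (by omega)
    rw [← constantCoeff_eq, constantCoeff_taylorAt, hg]
  have := Ideal.mem_map_of_mem (taylorAt v) hf
  rw [Ideal.map_pow] at this
  exact Ideal.pow_right_mono hle m this

theorem exists_linear_form_mem_pointIdeal (v : Fin 4 → K) :
    ∃ l ∈ pointIdeal K v, l ≠ 0 ∧ l.IsHomogeneous 1 := by
  by_cases hv : v 0 = 0
  · exact ⟨X 0, Ideal.subset_span ⟨isHomogeneous_X _ _, by simp [hv]⟩, X_ne_zero 0,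
      isHomogeneous_X _ _⟩
  · have hl : (C (v 1) * X 0 - C (v 0) * X 1 : MvPolynomial (Fin 4) K).IsHomogeneous 1 :=
      (isHomogeneous_C_mul_X _ _).sub (isHomogeneous_C_mul_X _ _)
    refine ⟨_, Ideal.subset_span ⟨hl, by simp [mul_comm]⟩, fun h => hv ?_, hl⟩
    simpa using congrArg (eval (Pi.single 1 1)) h

theorem exists_form_mem_iInf_pointIdeal_pow {n : ℕ} (v : Fin n → Fin 4 → K) (m : ℕ) :
    ∃ t, ∃ f ∈ ⨅ j, pointIdeal K (v j) ^ m, f ≠ 0 ∧ f.IsHomogeneous t := by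
  choose l hl hl0 hlh using fun j => exists_linear_form_mem_pointIdeal (v j)
  refine ⟨_, ∏ j, l j ^ m, ?_, Finset.prod_ne_zero_iff.2 fun j _ => pow_ne_zero _ (hl0 j),
    IsHomogeneous.prod _ _ _ fun j _ => (hlh j).pow m⟩
  refine Ideal.mem_iInf.2 fun j => ?_
  exact Ideal.mem_of_dvd _ (Finset.dvd_prod_of_mem _ (Finset.mem_univ j))
    (Ideal.pow_mem_pow (hl j) m)

/-- For `n ≥ k ^ 3` general points of `ℙ³`, every form vanishing to order `m` at all of them has
degree at least `m * k`. -/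
theorem exists_generic_mul_le_alphaDeg [CharZero K] {n k : ℕ} (hk : k ^ 3 ≤ n) (hk0 : 0 < k)
    (m : ℕ) :
    ∃ G : MvPolynomial (Fin n × Fin 4) K, G ≠ 0 ∧
      ∀ v : Fin n → Fin 4 → K, eval (fun p => v p.1 p.2) G ≠ 0 →
        m * k ≤ alphaDeg (⨅ j, pointIdeal K (v j) ^ m) := by
  have : NeZero k := ⟨hk0.ne'⟩
  obtain ⟨e⟩ : Nonempty ((Fin 3 → Fin k) ↪ Fin n) :=
    Function.Embedding.nonempty_of_card_le (by simpa using hk)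
  let v₀ (j : Fin n) : Fin 4 → K :=
    Fin.cons 1 fun i => ((Function.invFun e j i : ℕ) : K)
  have hv₀ (t : ℕ) (ht : t < m * k) (f : MvPolynomial (Fin 4) K) (hf : f.IsHomogeneous t)
      (h : ∀ j, taylorAt (v₀ j) f ∈ idealOfVars (Fin 4) K ^ m) : f = 0 := by
    refine hf.eq_zero_of_taylorAt_mem_of_grid (m := m)
      (S := (Finset.range k).map Nat.castEmbedding) (by simpa using ht) fun a ha => ?_
    simp only [Finset.mem_map, Finset.mem_range, Nat.castEmbedding_apply] at ha
    choose b hb hba using ha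
    have := h (e fun i => ⟨b i, hb i⟩)
    simpa only [v₀, Function.leftInverse_invFun e.injective _, hba] using this
  choose! G hG₀ hG using fun t ht =>
    exists_eval_ne_zero_and_forall_isHomogeneous_eq_zero m t v₀ (hv₀ t ht)
  refine ⟨∏ t ∈ Finset.range (m * k), G t, fun h => ?_, fun v hv => ?_⟩
  · have h' := congrArg (eval fun p => v₀ p.1 p.2) h
    rw [map_prod, map_zero, Finset.prod_eq_zero_iff] at h'
    obtain ⟨t, ht, h'⟩ := h'
    exact hG₀ t (Finset.mem_range.1 ht) h'
  · refine le_csInf (exists_form_mem_iInf_pointIdeal_pow v m) ?_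
    rintro t ⟨f, hfI, hf0, hf⟩
    by_contra! ht
    rw [map_prod, Finset.prod_ne_zero_iff] at hv
    exact hf0 (hG t ht v (hv t (Finset.mem_range.2 ht)) f hf fun j =>
      taylorAt_mem_of_mem_pointIdeal_pow (Ideal.mem_iInf.1 hfI j))

end PointIdeal

theorem deltaBound_eq (n : ℕ) :
    deltaBound n = (3 * (6 ^ ((1 : ℝ) / 3) * (n : ℝ) ^ ((1 : ℝ) / 3)) + 4.3) / 7 := by
  rw [deltaBound, Real.mul_rpow (by norm_num) (Nat.cast_nonneg n)]

theorem rpow_one_third_pow_three {x : ℝ} (hx : 0 ≤ x) : (x ^ ((1 : ℝ) / 3)) ^ 3 = x := by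
  rw [← Real.rpow_natCast, ← Real.rpow_mul hx]
  norm_num

theorem six_rpow_one_third_bounds :
    (1.817 : ℝ) ≤ 6 ^ ((1 : ℝ) / 3) ∧ (6 : ℝ) ^ ((1 : ℝ) / 3) ≤ 1.8172 := by
  have h := rpow_one_third_pow_three (x := 6) (by norm_num)
  have h0 : (0 : ℝ) ≤ 6 ^ ((1 : ℝ) / 3) := by positivity
  constructor
  · refine le_of_pow_le_pow_left₀ three_ne_zero h0 ?_
    rw [h]; norm_num
  · refine le_of_pow_le_pow_left₀ three_ne_zero (by norm_num) ?_
    rw [h]; norm_num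

theorem exists_pow_three_le_and_deltaBound_le {n : ℕ} (hn : 512 ≤ n) :
    ∃ k : ℕ, 0 < k ∧ k ^ 3 ≤ n ∧ deltaBound n ≤ k := by
  have hx3 := rpow_one_third_pow_three (Nat.cast_nonneg (α := ℝ) n)
  rw [funext deltaBound_eq]
  set x : ℝ := (n : ℝ) ^ ((1 : ℝ) / 3)
  have hx0 : 0 ≤ x := by positivity
  have hx8 : 8 ≤ x := by
    refine le_of_pow_le_pow_left₀ three_ne_zero hx0 ?_
    rw [hx3]
    have : (512 : ℝ) ≤ n := by exact_mod_cast hn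
    linarith
  have hk8 : 8 ≤ ⌊x⌋₊ := Nat.le_floor (by exact_mod_cast hx8)
  have hkx : (⌊x⌋₊ : ℝ) ≤ x := Nat.floor_le hx0
  refine ⟨⌊x⌋₊, by omega, ?_, ?_⟩
  · have := pow_le_pow_left₀ (Nat.cast_nonneg _) hkx 3
    rw [hx3] at this
    exact_mod_cast this
  · have hlt := Nat.lt_floor_add_one x
    have hk8' : (8 : ℝ) ≤ ⌊x⌋₊ := by exact_mod_cast hk8
    have := mul_le_mul_of_nonneg_right six_rpow_one_third_bounds.2 hx0
    dsimp only
    linarith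

/-- For `n ≥ 512` points in general position in `ℙ³`: `α(I^(m)) ≥ m·δ(n)` for all
`m ≥ 1`, `δ(n) ≥ 0.7787·n^(1/3) + 0.6142`, and hence the Waldschmidt constant
satisfies `γ(n) ≥ δ(n) ≥ 0.7787·n^(1/3) + 0.6142`. -/
theorem waldschmidt_bound_large_n (K : Type) [Field K] [CharZero K] (n : ℕ)
    (hn : 512 ≤ n) :
    (∀ m : ℕ, 1 ≤ m →
      ∃ G : MvPolynomial (Fin n × Fin 4) K, G ≠ 0 ∧
        ∀ v : Fin n → Fin 4 → K, (∀ j, v j ≠ 0) →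
          eval (fun p => v p.1 p.2) G ≠ 0 →
          (m : ℝ) * deltaBound n ≤ alphaDeg (⨅ j, pointIdeal K (v j) ^ m)) ∧
    (0.7787 * (n : ℝ) ^ ((1 : ℝ) / 3) + 0.6142 ≤ deltaBound n) ∧
    (∀ v : Fin n → Fin 4 → K, (∀ j, v j ≠ 0) →
      (∀ m : ℕ, 1 ≤ m →
        (m : ℝ) * deltaBound n ≤ alphaDeg (⨅ j, pointIdeal K (v j) ^ m)) →
      ∀ γ : ℝ,
        Tendsto (fun k : ℕ => (alphaDeg (⨅ j, pointIdeal K (v j) ^ k) : ℝ) / k)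
          atTop (nhds γ) →
        deltaBound n ≤ γ) := by
  refine ⟨fun m _ => ?_, ?_, fun v _ hv γ hγ => ?_⟩
  · obtain ⟨k, hk0, hkn, hk⟩ := exists_pow_three_le_and_deltaBound_le hn
    obtain ⟨G, hG0, hG⟩ := exists_generic_mul_le_alphaDeg (K := K) hkn hk0 m
    refine ⟨G, hG0, fun v _ hv => (mul_le_mul_of_nonneg_left hk (Nat.cast_nonneg m)).trans ?_⟩
    exact_mod_cast hG v hv
  · rw [deltaBound_eq]
    have hx0 : 0 ≤ (n : ℝ) ^ ((1 : ℝ) / 3) := by positivity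
    have := mul_le_mul_of_nonneg_right six_rpow_one_third_bounds.1 hx0
    linarith
  · refine ge_of_tendsto hγ ?_
    filter_upwards [eventually_ge_atTop 1] with k hk
    rw [le_div_iff₀ (by exact_mod_cast hk), mul_comm]
    exact hv k hk

end
end

section
/- Let K be a field of characteristic zero and let n ∈ {5,6}. Then there exists a nonzero polynomial G in 4n variables over K such that for every tuple (v_1,…,v_n) of nonzero vectors in K^4 with G(v_1,…,v_n) ≠ 0, the ideal I = ⋂_{j=1}^n m_{v_j} of the corresponding simple points in P^3 satisfies I^{(4)} ⊆ M²·I². -/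
open MvPolynomial Filter

noncomputable section

/-- The irrelevant maximal ideal `M = (x₀, x₁, x₂, x₃)`. -/
def irrIdeal (K : Type) [Field K] : Ideal (MvPolynomial (Fin 4) K) :=
  Ideal.span (Set.range X)

/-- The forms of degree `d` in four variables that vanish on `Z`. -/
def formsOn {K : Type} [Field K] (d : ℕ) (Z : Set (Fin 4 → K)) :
    Submodule K (MvPolynomial (Fin 4) K) where
  carrier := {f | f.IsHomogeneous d ∧ ∀ z ∈ Z, eval z f = 0}
  add_mem' := fun hf hg => ⟨hf.1.add hg.1, fun z hz => by simp [hf.2 z hz, hg.2 z hz]⟩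
  zero_mem' := ⟨isHomogeneous_zero _ _ _, fun z _ => by simp⟩
  smul_mem' := fun c f hf => ⟨by
    rw [smul_eq_C_mul]
    exact hf.1.C_mul c, fun z hz => by simp [smul_eval, hf.2 z hz]⟩

/-- The polynomials vanishing at `p` together with all their first partial derivatives. -/
def singularAt {K : Type} [Field K] (p : Fin 4 → K) :
    Submodule K (MvPolynomial (Fin 4) K) where
  carrier := {f | eval p f = 0 ∧ ∀ i, eval p (pderiv i f) = 0}
  add_mem' := fun hf hg => ⟨by simp [hf.1, hg.1], fun i => by simp [hf.2 i, hg.2 i]⟩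
  zero_mem' := ⟨by simp, fun i => by simp⟩
  smul_mem' := fun c f hf => ⟨by simp [smul_eval, hf.1], fun i => by simp [smul_eval, hf.2 i]⟩

section Forms

variable {K : Type} [Field K]

theorem mem_formsOn {d : ℕ} {Z : Set (Fin 4 → K)} {f : MvPolynomial (Fin 4) K} :
    f ∈ formsOn d Z ↔ f.IsHomogeneous d ∧ ∀ z ∈ Z, eval z f = 0 := Iff.rfl

theorem mem_singularAt {p : Fin 4 → K} {f : MvPolynomial (Fin 4) K} :
    f ∈ singularAt p ↔ eval p f = 0 ∧ ∀ i, eval p (pderiv i f) = 0 := Iff.rfl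

theorem formsOn_anti (d : ℕ) {Z Z' : Set (Fin 4 → K)} (h : Z ⊆ Z') :
    formsOn d Z' ≤ formsOn d Z := fun _ hf => ⟨hf.1, fun z hz => hf.2 z (h hz)⟩

theorem formsOn_mul_le (d e : ℕ) (Y Z : Set (Fin 4 → K)) :
    formsOn d Y * formsOn e Z ≤ formsOn (d + e) (Y ∪ Z) := by
  refine Submodule.mul_le.2 fun f hf g hg => ⟨hf.1.mul hg.1, ?_⟩
  rintro z (hz | hz)
  · simp [hf.2 z hz]
  · simp [hg.2 z hz]

theorem formsOn_empty (d : ℕ) :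
    formsOn d (∅ : Set (Fin 4 → K)) = homogeneousSubmodule (Fin 4) K d := by
  ext f
  simp [mem_formsOn]

theorem formsOn_one_empty_pow (d : ℕ) :
    (formsOn 1 (∅ : Set (Fin 4 → K))) ^ d = formsOn d ∅ := by
  rw [formsOn_empty, formsOn_empty, homogeneousSubmodule_one_pow]

theorem constant_eq_zero_of_eval {f : MvPolynomial (Fin 4) K}
    (hf : f.IsHomogeneous 0) {p : Fin 4 → K} (h : eval p f = 0) : f = 0 := by
  rw [← totalDegree_zero_iff_isHomogeneous, totalDegree_eq_zero_iff_eq_C] at hf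
  rw [hf] at h ⊢
  simpa using h

theorem linear_eq_zero_of_eval_pderiv {m : MvPolynomial (Fin 4) K}
    (hm : m.IsHomogeneous 1) {p : Fin 4 → K} (h : ∀ i, eval p (pderiv i m) = 0) : m = 0 := by
  have h1 := hm.sum_X_mul_pderiv
  rw [one_smul] at h1
  rw [← h1]
  refine Finset.sum_eq_zero fun i _ => ?_
  rw [constant_eq_zero_of_eval (hm.pderiv (i := i)) (h i), mul_zero]

theorem mul_mul_le_singularAt {p : Fin 4 → K} {Z : Set (Fin 4 → K)} (hp : p ∈ Z) (d e : ℕ)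
    (V : Submodule K (MvPolynomial (Fin 4) K)) :
    V * (formsOn d Z * formsOn e Z) ≤ singularAt p := by
  refine Submodule.mul_le.2 fun a _ b hb => ?_
  have hb' : b ∈ singularAt p := by
    revert b
    refine Submodule.mul_le.2 fun f hf g hg => ?_
    simp [mem_singularAt, hf.2 p hp, hg.2 p hp]
  simp [mem_singularAt, hb'.1, hb'.2]

/-- Every form is a linear combination of a power of `l` and a form in the ideal of `p`. -/
theorem pow_le_vanishing_mul_add {p : Fin 4 → K} {l : MvPolynomial (Fin 4) K}
    (hl : l ∈ formsOn 1 (∅ : Set (Fin 4 → K))) (hlp : eval p l = 1) (d : ℕ) :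
    (formsOn 1 (∅ : Set (Fin 4 → K))) ^ (d + 1) ≤
      formsOn 1 {p} * formsOn 1 ∅ ^ d + Submodule.span K {l ^ (d + 1)} := by
  have h1 : formsOn 1 (∅ : Set (Fin 4 → K)) ≤ formsOn 1 {p} + Submodule.span K {l} := by
    intro f hf
    refine Submodule.mem_sup.2 ⟨f - eval p f • l, ?_, eval p f • l,
      Submodule.smul_mem _ _ (Submodule.mem_span_singleton_self l), by ring⟩
    refine ⟨((formsOn 1 (∅ : Set (Fin 4 → K))).sub_mem hf (Submodule.smul_mem _ _ hl)).1, ?_⟩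
    simp [smul_eval, hlp]
  induction d with
  | zero => simpa using h1
  | succ d ih =>
    have hs : Submodule.span K {l} * Submodule.span K {l ^ (d + 1)} =
        Submodule.span K {l ^ (d + 1 + 1)} := by
      rw [Submodule.span_mul_span, Set.singleton_mul_singleton, ← pow_succ']
    calc (formsOn 1 (∅ : Set (Fin 4 → K))) ^ (d + 1 + 1)
        = formsOn 1 ∅ * formsOn 1 ∅ ^ (d + 1) := pow_succ' _ _
      _ ≤ formsOn 1 ∅ * (formsOn 1 {p} * formsOn 1 ∅ ^ d + Submodule.span K {l ^ (d + 1)}) :=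
          mul_le_mul_right ih _
      _ = formsOn 1 {p} * formsOn 1 ∅ ^ (d + 1) +
            formsOn 1 ∅ * Submodule.span K {l ^ (d + 1)} := by ring
      _ ≤ formsOn 1 {p} * formsOn 1 ∅ ^ (d + 1) +
            (formsOn 1 {p} + Submodule.span K {l}) * Submodule.span K {l ^ (d + 1)} :=
          add_le_add_right (mul_le_mul_left h1 _) _
      _ = formsOn 1 {p} * (formsOn 1 ∅ ^ (d + 1) + Submodule.span K {l ^ (d + 1)}) +
            Submodule.span K {l ^ (d + 1 + 1)} := by rw [← hs]; ring
      _ ≤ _ := by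
          refine add_le_add_left (mul_le_mul_right (sup_le le_rfl ?_) _) _
          simpa using Submodule.pow_mem_pow _ hl (d + 1)

theorem quadric_mem_sq_of_singularAt {p : Fin 4 → K} {l : MvPolynomial (Fin 4) K}
    (hl : l ∈ formsOn 1 (∅ : Set (Fin 4 → K))) (hlp : eval p l = 1)
    {f : MvPolynomial (Fin 4) K} (hf : f ∈ formsOn 2 (∅ : Set (Fin 4 → K)))
    (hs : f ∈ singularAt p) : f ∈ formsOn 1 {p} * formsOn 1 {p} := by
  have h1 := pow_le_vanishing_mul_add hl hlp 0
  have h2 := pow_le_vanishing_mul_add hl hlp 1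
  simp only [zero_add, pow_one, pow_zero, mul_one, Nat.reduceAdd] at h1 h2
  rw [← formsOn_one_empty_pow] at hf
  have h3 : formsOn 1 {p} * formsOn 1 ∅ + Submodule.span K {l ^ 2} ≤
      formsOn 1 {p} * formsOn 1 {p} + formsOn 1 {p} * Submodule.span K {l} +
        Submodule.span K {l ^ 2} := by
    rw [← mul_add]
    exact add_le_add_left (mul_le_mul_right h1 _) _
  obtain ⟨g, hg, c, hc, rfl⟩ := Submodule.mem_sup.1 (h3 (h2 hf))
  obtain ⟨n, hn, b, hb, rfl⟩ := Submodule.mem_sup.1 hg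
  obtain ⟨a, rfl⟩ := Submodule.mem_span_singleton.1 hc
  obtain ⟨m, hm, rfl⟩ := Submodule.mem_mul_span_singleton.1 hb
  have hns : n ∈ singularAt p := by
    have := mul_mul_le_singularAt (p := p) (Set.mem_singleton p) 1 1 (1 : Submodule K _)
    rw [one_mul] at this
    exact this hn
  have hmp := hm.2 p rfl
  have ha : a = 0 := by
    have := hs.1
    simpa [hns.1, hmp, hlp, smul_eval] using this
  subst ha
  have hm0 : m = 0 := by
    refine linear_eq_zero_of_eval_pderiv hm.1 (p := p) fun i => ?_
    have := hs.2 i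
    simpa [hns.2 i, hmp, hlp, pderiv_mul] using this
  simpa [hm0] using hn

/-- A form in the square of the quadrics through `Z` which is singular at `p` lies in the square of
the quadrics through `Z` and `p`. -/
theorem mem_sq_insert_of_singularAt {Z : Set (Fin 4 → K)} {p : Fin 4 → K}
    {u l : MvPolynomial (Fin 4) K}
    (hl : l ∈ formsOn 1 (∅ : Set (Fin 4 → K))) (hlp : eval p l = 1)
    (hu : u ∈ formsOn 2 Z) (hup : eval p u = 1)
    (hmul : ∀ m ∈ formsOn 1 {p}, m * u ∈ formsOn 1 (∅ : Set (Fin 4 → K)) * formsOn 2 (insert p Z))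
    (s : ℕ) {f : MvPolynomial (Fin 4) K}
    (hf : f ∈ formsOn 1 (∅ : Set (Fin 4 → K)) ^ (s + 2) * (formsOn 2 Z * formsOn 2 Z))
    (hs : f ∈ singularAt p) :
    f ∈ formsOn 1 (∅ : Set (Fin 4 → K)) ^ (s + 2) *
      (formsOn 2 (insert p Z) * formsOn 2 (insert p Z)) := by
  set A := formsOn 1 (∅ : Set (Fin 4 → K)) with hA
  set L := formsOn 1 {p} with hL
  set Q := formsOn 2 (insert p Z) with hQ
  set U := Submodule.span K {u} with hU
  set W := Submodule.span K {u * l ^ s} with hW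
  have hLU : L * U ≤ A * Q := by
    intro x hx
    obtain ⟨m, hm, rfl⟩ := Submodule.mem_mul_span_singleton.1 hx
    exact hmul m hm
  have hZ : formsOn 2 Z ≤ Q + U := by
    intro x hx
    refine Submodule.mem_sup.2 ⟨x - eval p x • u, ?_, eval p x • u,
      Submodule.smul_mem _ _ (Submodule.mem_span_singleton_self u), by ring⟩
    have h := (formsOn 2 Z).sub_mem hx (Submodule.smul_mem _ (eval p x) hu)
    refine ⟨h.1, ?_⟩
    rintro z (rfl | hz)
    · simp [smul_eval, hup]
    · exact h.2 z hz
  have hAW : A ^ (s + 2) ≤ L * A ^ (s + 1) + W := by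
    intro x hx
    have h := pow_le_vanishing_mul_add hl hlp (s + 1)
    have hw : u * l ^ s ∈ A ^ (s + 2) := by
      rw [add_comm, pow_add]
      refine Submodule.mul_mem_mul ?_ (Submodule.pow_mem_pow _ hl s)
      rw [hA, formsOn_one_empty_pow]
      exact formsOn_anti 2 (Set.empty_subset _) hu
    obtain ⟨m, hm, c, hc, rfl⟩ := Submodule.mem_sup.1 (h hx)
    obtain ⟨m', hm', c', hc', hmc⟩ := Submodule.mem_sup.1 (h hw)
    obtain ⟨a, rfl⟩ := Submodule.mem_span_singleton.1 hc
    obtain ⟨a', rfl⟩ := Submodule.mem_span_singleton.1 hc'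
    have hm'p : eval p m' = 0 := by
      have := (formsOn_mul_le 1 (s + 1) {p} (∅ : Set (Fin 4 → K)))
        (by rwa [← formsOn_one_empty_pow])
      exact this.2 p (by simp)
    have ha' : a' = 1 := by
      have := congrArg (eval p) hmc
      simpa [smul_eval, hm'p, hlp, hup] using this
    subst ha'
    refine Submodule.mem_sup.2 ⟨m - a • m', Submodule.sub_mem _ hm (Submodule.smul_mem _ _ hm'),
      a • (u * l ^ s), Submodule.smul_mem _ _ (Submodule.mem_span_singleton_self _), ?_⟩
    rw [← hmc, one_smul, smul_add]
    abel
  have h1 : A ^ (s + 2) * (U * Q) ≤ A ^ (s + 2) * (Q * Q) + W * (U * Q) := calc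
    A ^ (s + 2) * (U * Q) ≤ (L * A ^ (s + 1) + W) * (U * Q) := mul_le_mul_left hAW _
    _ = (L * U) * (A ^ (s + 1) * Q) + W * (U * Q) := by ring
    _ ≤ (A * Q) * (A ^ (s + 1) * Q) + W * (U * Q) := add_le_add_left (mul_le_mul_left hLU _) _
    _ = _ := by ring
  have h2 : A ^ (s + 2) * (U * U) ≤ A ^ (s + 2) * (U * Q) + W * (U * U) := calc
    A ^ (s + 2) * (U * U) ≤ (L * A ^ (s + 1) + W) * (U * U) := mul_le_mul_left hAW _
    _ = (L * U) * (A ^ (s + 1) * U) + W * (U * U) := by ring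
    _ ≤ (A * Q) * (A ^ (s + 1) * U) + W * (U * U) := add_le_add_left (mul_le_mul_left hLU _) _
    _ = _ := by ring
  have h3 : A ^ (s + 2) * (formsOn 2 Z * formsOn 2 Z) ≤
      A ^ (s + 2) * (Q * Q) + W * (U * Q) + W * (U * U) := calc
    _ ≤ A ^ (s + 2) * ((Q + U) * (Q + U)) := mul_le_mul_right (mul_le_mul' hZ hZ) _
    _ = A ^ (s + 2) * (Q * Q) + (A ^ (s + 2) * (U * Q) + A ^ (s + 2) * (U * Q)) +
          A ^ (s + 2) * (U * U) := by ring
    _ = A ^ (s + 2) * (Q * Q) + A ^ (s + 2) * (U * Q) + A ^ (s + 2) * (U * U) := by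
        rw [add_idem (A ^ (s + 2) * (U * Q))]
    _ ≤ A ^ (s + 2) * (Q * Q) + W * (U * Q) + W * (U * U) := by
        refine sup_le (sup_le ?_ ?_) (h2.trans (sup_le ?_ le_sup_right))
        · exact le_sup_left.trans le_sup_left
        · exact h1.trans le_sup_left
        · exact h1.trans le_sup_left
  obtain ⟨g', hg', y, hy, rfl⟩ := Submodule.mem_sup.1 (h3 hf)
  obtain ⟨g, hg, x, hx, rfl⟩ := Submodule.mem_sup.1 hg'
  obtain ⟨x', hx', rfl⟩ := Submodule.mem_span_singleton_mul.1 hx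
  obtain ⟨q, hq, rfl⟩ := Submodule.mem_span_singleton_mul.1 hx'
  obtain ⟨y', hy', rfl⟩ := Submodule.mem_span_singleton_mul.1 hy
  obtain ⟨y'', hy'', rfl⟩ := Submodule.mem_span_singleton_mul.1 hy'
  obtain ⟨a, rfl⟩ := Submodule.mem_span_singleton.1 hy''
  have hgs : g ∈ singularAt p := mul_mul_le_singularAt (Set.mem_insert p Z) 2 2 _ hg
  have hqp : eval p q = 0 := hq.2 p (Set.mem_insert p Z)
  have ha : a = 0 := by
    have := hs.1
    simpa [hgs.1, hqp, hlp, hup, smul_eval] using this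
  subst ha
  have hqs : q ∈ singularAt p := by
    refine ⟨hqp, fun i => ?_⟩
    have := hs.2 i
    simpa [hgs.2 i, hqp, hlp, hup, pderiv_mul] using this
  have hqL := quadric_mem_sq_of_singularAt hl hlp
    (formsOn_anti 2 (Set.empty_subset _) hq) hqs
  have h4 : u * l ^ s * (u * q) ∈ A ^ (s + 2) * (Q * Q) := by
    have h5 : A ^ s * ((L * U) * (L * U)) ≤ A ^ (s + 2) * (Q * Q) := calc
      _ ≤ A ^ s * ((A * Q) * (A * Q)) := mul_le_mul_right (mul_le_mul' hLU hLU) _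
      _ = _ := by ring
    apply h5
    have h6 : u * l ^ s * (u * q) ∈ A ^ s * ((U * U) * (L * L)) := by
      have : u * l ^ s * (u * q) = l ^ s * ((u * u) * q) := by ring
      rw [this]
      exact Submodule.mul_mem_mul (Submodule.pow_mem_pow _ hl s) (Submodule.mul_mem_mul
        (Submodule.mul_mem_mul (Submodule.mem_span_singleton_self u)
          (Submodule.mem_span_singleton_self u)) hqL)
    convert h6 using 2
    ring
  simpa using Submodule.add_mem _ hg h4

/-- Any four of the six vectors are linearly independent. -/
def GeneralPosition (q : Fin 6 → Fin 4 → K) : Prop :=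
  ∀ σ : Fin 4 → Fin 6, Function.Injective σ → (Matrix.of fun a => q (σ a)).det ≠ 0

theorem exists_dual_forms {w : Fin 4 → Fin 4 → K} (hw : (Matrix.of w).det ≠ 0) :
    ∃ L : Fin 4 → MvPolynomial (Fin 4) K, (∀ a, (L a).IsHomogeneous 1) ∧
      (∀ a b, eval (w b) (L a) = if a = b then 1 else 0) ∧
      (∀ i, X i = ∑ a, w a i • L a) ∧
      ∀ m : MvPolynomial (Fin 4) K, m.IsHomogeneous 1 → m = ∑ a, eval (w a) m • L a := by
  have hu : IsUnit (Matrix.of w).det := isUnit_iff_ne_zero.2 hw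
  set B := (Matrix.of w)⁻¹ with hB
  have h1 : Matrix.of w * B = 1 := Matrix.mul_nonsing_inv _ hu
  have h2 : B * Matrix.of w = 1 := Matrix.nonsing_inv_mul _ hu
  have hX : ∀ i, (X i : MvPolynomial (Fin 4) K) = ∑ a, w a i • ∑ j, C (B j a) * X j := by
    intro i
    have h : ∀ j, ∑ a, w a i * B j a = if j = i then 1 else 0 := by
      intro j
      have := congrFun (congrFun h2 j) i
      rw [Matrix.mul_apply, Matrix.one_apply] at this
      rw [← this]
      exact Finset.sum_congr rfl fun a _ => mul_comm _ _
    simp_rw [smul_eq_C_mul, Finset.mul_sum]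
    rw [Finset.sum_comm]
    simp_rw [← mul_assoc, ← C_mul, ← Finset.sum_mul, ← map_sum, h]
    simp
  refine ⟨fun a => ∑ j, C (B j a) * X j, fun a => ?_, fun a b => ?_, hX, fun m hm => ?_⟩
  · exact IsHomogeneous.sum _ _ _ fun j _ => isHomogeneous_C_mul_X _ _
  · have := congrFun (congrFun h1 b) a
    rw [Matrix.mul_apply, Matrix.one_apply] at this
    simp only [map_sum, map_mul, eval_C, eval_X, eq_comm (a := a), ← this]
    exact Finset.sum_congr rfl fun a _ => mul_comm _ _
  · have hm' : m ∈ Submodule.span K (Set.range (X : Fin 4 → MvPolynomial (Fin 4) K)) := by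
      rwa [← homogeneousSubmodule_one_eq_span_X]
    induction hm' using Submodule.span_induction with
    | mem x hx =>
      obtain ⟨i, rfl⟩ := hx
      simpa using hX i
    | zero => simp
    | add x y hx hy ihx ihy =>
      rw [← homogeneousSubmodule_one_eq_span_X] at hx hy
      conv_lhs => rw [ihx hx, ihy hy]
      simp [add_smul, Finset.sum_add_distrib]
    | smul c x hx ihx =>
      rw [← homogeneousSubmodule_one_eq_span_X] at hx
      conv_lhs => rw [ihx hx]
      simp [Finset.smul_sum, smul_smul, smul_eval]

theorem GeneralPosition.exists_plane {q : Fin 6 → Fin 4 → K} (hq : GeneralPosition q)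
    {a b c d : Fin 6} (h : Function.Injective ![a, b, c, d]) :
    ∃ l ∈ formsOn 1 {q a, q b, q c}, eval (q d) l = 1 := by
  obtain ⟨L, hL, hd, -, -⟩ := exists_dual_forms (hq _ h)
  refine ⟨L 3, ⟨hL 3, ?_⟩, by simpa using hd 3 3⟩
  rintro z (rfl | rfl | rfl)
  · simpa using hd 3 0
  · simpa using hd 3 1
  · simpa using hd 3 2

/-- If `m` is a plane through three of six points and `u` a quadric through all of them except one
of these three, then `m * u` is generated by the quadrics through all six points. -/
theorem GeneralPosition.plane_mul_mem {q : Fin 6 → Fin 4 → K} (hq : GeneralPosition q)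
    {m u : MvPolynomial (Fin 4) K} {Z : Set (Fin 4 → K)}
    (a b c d e k : Fin 6) (hσ : Function.Injective ![a, b, c, d, e, k])
    (hZ : Z = {q a, q b, q c, q d, q e})
    (hm : m ∈ formsOn 1 {q k, q d, q e}) (hu : u ∈ formsOn 2 Z) (huk : eval (q k) u = 1) :
    m * u ∈ formsOn 1 (∅ : Set (Fin 4 → K)) * formsOn 2 (insert (q k) Z) := by
  subst hZ
  have inj : ∀ τ : Fin 4 → Fin 6, Function.Injective τ →
      Function.Injective (![a, b, c, d, e, k] ∘ τ) := fun τ hτ => hσ.comp hτ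
  obtain ⟨l, hl, hlk⟩ := hq.exists_plane (a := a) (b := b) (c := c) (d := k)
    (by convert inj ![0, 1, 2, 5] (by decide) using 1; ext i; fin_cases i <;> rfl)
  obtain ⟨l', hl', hlk'⟩ := hq.exists_plane (a := a) (b := d) (c := e) (d := k)
    (by convert inj ![0, 3, 4, 5] (by decide) using 1; ext i; fin_cases i <;> rfl)
  have h1 : m * l ∈ formsOn 2 (insert (q k) {q a, q b, q c, q d, q e}) := by
    refine formsOn_anti 2 ?_ (formsOn_mul_le 1 1 _ _ (Submodule.mul_mem_mul hm hl))
    intro x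
    simp only [Set.mem_insert_iff, Set.mem_singleton_iff, Set.mem_union]
    tauto
  have h2 : u - l * l' ∈ formsOn 2 (insert (q k) {q a, q b, q c, q d, q e}) := by
    have h := formsOn_anti 2 (Z := {q a, q b, q c, q d, q e}) ?_
      (formsOn_mul_le 1 1 _ _ (Submodule.mul_mem_mul hl hl'))
    · have h' := Submodule.sub_mem _ hu h
      refine ⟨h'.1, ?_⟩
      rintro z (rfl | hz)
      · simp [huk, hlk, hlk']
      · exact h'.2 z hz
    · intro x
      simp only [Set.mem_insert_iff, Set.mem_singleton_iff, Set.mem_union]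
      tauto
  have h3 : m * u = l' * (m * l) + m * (u - l * l') := by ring
  rw [h3]
  exact Submodule.add_mem _
    (Submodule.mul_mem_mul (formsOn_anti 1 (Set.empty_subset _) hl') h1)
    (Submodule.mul_mem_mul (formsOn_anti 1 (Set.empty_subset _) hm) h2)

theorem GeneralPosition.comp {q : Fin 6 → Fin 4 → K} (hq : GeneralPosition q)
    (e : Equiv.Perm (Fin 6)) : GeneralPosition (q ∘ e) :=
  fun σ hσ => hq (e ∘ σ) (e.injective.comp hσ)

theorem GeneralPosition.exists_quadric_aux {q : Fin 6 → Fin 4 → K} (hq : GeneralPosition q) :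
    ∃ u ∈ formsOn 2 {q 0, q 1, q 2, q 3, q 4}, eval (q 5) u = 1 ∧ ∀ m ∈ formsOn 1 {q 5},
      m * u ∈ formsOn 1 (∅ : Set (Fin 4 → K)) *
        formsOn 2 (insert (q 5) {q 0, q 1, q 2, q 3, q 4}) := by
  obtain ⟨l, hl, hlk⟩ := hq.exists_plane (a := 0) (b := 1) (c := 2) (d := 5) (by decide)
  obtain ⟨l', hl', hlk'⟩ := hq.exists_plane (a := 0) (b := 3) (c := 4) (d := 5) (by decide)
  have hu : l * l' ∈ formsOn 2 {q 0, q 1, q 2, q 3, q 4} := by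
    refine formsOn_anti 2 ?_ (formsOn_mul_le 1 1 _ _ (Submodule.mul_mem_mul hl hl'))
    intro x
    simp only [Set.mem_insert_iff, Set.mem_singleton_iff, Set.mem_union]
    tauto
  have hu5 : eval (q 5) (l * l') = 1 := by simp [hlk, hlk']
  refine ⟨l * l', hu, hu5, fun m hm => ?_⟩
  obtain ⟨L, hL, hd, -, hs⟩ := exists_dual_forms (hq ![2, 3, 4, 5] (by decide))
  have hm5 := hm.2 (q 5) rfl
  rw [hs m hm.1, Fin.sum_univ_four, add_mul, add_mul, add_mul]
  simp only [Matrix.cons_val, hm5, zero_smul, zero_mul, add_zero, smul_mul_assoc]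
  refine Submodule.add_mem _ (Submodule.add_mem _ ?_ ?_) ?_ <;> refine Submodule.smul_mem _ _ ?_
  · refine hq.plane_mul_mem 0 1 2 3 4 5 (by decide) rfl ⟨hL 0, ?_⟩ hu hu5
    rintro z (rfl | rfl | rfl)
    exacts [by simpa using hd 0 3, by simpa using hd 0 1, by simpa using hd 0 2]
  · refine hq.plane_mul_mem 0 1 3 2 4 5 (by decide) (by grind) ⟨hL 1, ?_⟩ hu hu5
    rintro z (rfl | rfl | rfl)
    exacts [by simpa using hd 1 3, by simpa using hd 1 0, by simpa using hd 1 2]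
  · refine hq.plane_mul_mem 0 1 4 2 3 5 (by decide) (by grind) ⟨hL 2, ?_⟩ hu hu5
    rintro z (rfl | rfl | rfl)
    exacts [by simpa using hd 2 3, by simpa using hd 2 0, by simpa using hd 2 1]

theorem GeneralPosition.exists_quadric {q : Fin 6 → Fin 4 → K} (hq : GeneralPosition q)
    (k : Fin 6) :
    ∃ u ∈ formsOn 2 (q '' {k}ᶜ), eval (q k) u = 1 ∧ ∀ m ∈ formsOn 1 {q k},
      m * u ∈ formsOn 1 (∅ : Set (Fin 4 → K)) * formsOn 2 (insert (q k) (q '' {k}ᶜ)) := by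
  have h := (hq.comp (Equiv.swap k 5)).exists_quadric_aux
  have hset : ({(q ∘ Equiv.swap k 5) 0, (q ∘ Equiv.swap k 5) 1, (q ∘ Equiv.swap k 5) 2,
      (q ∘ Equiv.swap k 5) 3, (q ∘ Equiv.swap k 5) 4} : Set (Fin 4 → K)) = q '' {k}ᶜ := by
    have : ({k}ᶜ : Set (Fin 6)) = Equiv.swap k 5 '' {0, 1, 2, 3, 4} := by
      rw [show ({0, 1, 2, 3, 4} : Set (Fin 6)) = {5}ᶜ by ext i; fin_cases i <;> simp,
        Set.image_compl_eq (Equiv.bijective _)]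
      simp
    rw [this, ← Set.image_comp]
    simp [Set.image_insert_eq]
  rw [hset] at h
  simpa using h

theorem GeneralPosition.mem_sq_of_singularAt {q : Fin 6 → Fin 4 → K} (hq : GeneralPosition q)
    (s : ℕ) {f : MvPolynomial (Fin 4) K} (hf : f.IsHomogeneous (s + 6)) (S : Finset (Fin 6))
    (hs : ∀ j ∈ S, f ∈ singularAt (q j)) :
    f ∈ formsOn 1 (∅ : Set (Fin 4 → K)) ^ (s + 2) *
      (formsOn 2 (q '' S) * formsOn 2 (q '' S)) := by
  induction S using Finset.induction_on with
  | empty =>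
    rw [Finset.coe_empty, Set.image_empty, ← formsOn_one_empty_pow 2, ← pow_add, ← pow_add,
      formsOn_one_empty_pow]
    exact ⟨hf, by simp⟩
  | insert k S hk ih =>
    obtain ⟨u, hu, huk, hmul⟩ := hq.exists_quadric k
    obtain ⟨a, b, c, habc⟩ : ∃ a b c : Fin 6, Function.Injective ![a, b, c, k] :=
      (by decide : ∀ k : Fin 6, ∃ a b c : Fin 6, Function.Injective ![a, b, c, k]) k
    obtain ⟨l, hl, hlk⟩ := hq.exists_plane habc
    have hsub : q '' S ⊆ q '' {k}ᶜ := by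
      refine Set.image_mono fun j hj => ?_
      rintro rfl
      exact hk hj
    rw [Finset.coe_insert, Set.image_insert_eq]
    refine mem_sq_insert_of_singularAt (formsOn_anti 1 (Set.empty_subset _) hl) hlk
      (formsOn_anti 2 hsub hu) huk (fun m hm => ?_) s
      (ih fun j hj => hs j (Finset.mem_insert_of_mem hj)) (hs k (Finset.mem_insert_self _ _))
    exact mul_le_mul_right (formsOn_anti 2 (Set.insert_subset_insert hsub)) _ (hmul m hm)

theorem GeneralPosition.eval_dual_form_ne_zero {q : Fin 6 → Fin 4 → K} (hq : GeneralPosition q)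
    {m : MvPolynomial (Fin 4) K} (hm : m.IsHomogeneous 1) (hm0 : m ≠ 0) (a : Fin 4)
    (hma : ∀ b : Fin 4, b ≠ a → eval (q (![0, 1, 2, 3] b)) m = 0) : eval (q 4) m ≠ 0 := by
  intro h
  obtain ⟨L, -, -, -, hs⟩ := exists_dual_forms (hq (Function.update ![0, 1, 2, 3] a 4)
    ((by decide : ∀ a : Fin 4, Function.Injective
      (Function.update (![0, 1, 2, 3] : Fin 4 → Fin 6) a 4)) a))
  refine hm0 ((hs m hm).trans (Finset.sum_eq_zero fun b _ => ?_))
  by_cases hb : b = a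
  · subst hb
    simp [h]
  · simp [Function.update_of_ne hb, hma b hb]

theorem pderiv_pderiv_comm (i j : Fin 4) (f : MvPolynomial (Fin 4) K) :
    pderiv i (pderiv j f) = pderiv j (pderiv i f) := by
  have h : ⁅(pderiv i : Derivation K (MvPolynomial (Fin 4) K) (MvPolynomial (Fin 4) K)),
      (pderiv j : Derivation K (MvPolynomial (Fin 4) K) (MvPolynomial (Fin 4) K))⁆ = 0 := by
    refine derivation_ext fun k => ?_
    simp only [Derivation.commutator_apply, pderiv_X, Derivation.coe_zero, Pi.zero_apply]
    simp [Pi.single_apply, apply_ite]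
  have := DFunLike.congr_fun h f
  rwa [Derivation.commutator_apply, Derivation.zero_apply, sub_eq_zero] at this

/-- A totally symmetric cubic form on the coordinate space whose polar form vanishes on the squares
of the coordinate vectors and of a vector with nonzero coordinates is zero. -/
theorem symmetric_trilinear_eq_zero [CharZero K] {τ : Fin 4 → Fin 4 → Fin 4 → K}
    (h12 : ∀ a b c, τ a b c = τ b a c) (h23 : ∀ a b c, τ a b c = τ a c b)
    (hdiag : ∀ a c, τ a a c = 0) {μ : Fin 4 → K} (hμ : ∀ a, μ a ≠ 0)
    (h : ∀ c, ∑ a, ∑ b, μ a * (μ b * τ b a c) = 0) (a b c : Fin 4) : τ a b c = 0 := by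
  have hdiag' : ∀ a c, τ a c c = 0 := fun a c => by rw [h12, h23, hdiag]
  have hdiag'' : ∀ a c, τ a c a = 0 := fun a c => by rw [h23, hdiag]
  have hrot : ∀ a b c, τ a b c = τ b c a := fun a b c => by rw [h12, h23]
  have h0 := h 0
  have h1 := h 1
  have h2 := h 2
  have h3 := h 3
  simp only [Fin.sum_univ_four, hdiag, hdiag', hdiag'', mul_zero, add_zero, zero_add,
    hrot 1 2 0, hrot 1 3 0, hrot 2 3 0, h12 1 0, hrot 2 1 0, h12 2 0, h12 3 0, hrot 3 1 0, h12 3 1,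
    hrot 3 2 0, h12 2 1, h12 3 2, h23 0 2 1,
    h23 0 3 1, h23 0 3 2, h23 1 3 2, hrot 2 3 1] at h0 h1 h2 h3
  have cancel : ∀ {i j k : Fin 4} {t : K}, 6 * (μ i * μ j * μ k * t) = 0 → t = 0 := fun h => by
    simpa [hμ] using h
  have t012 : τ 0 1 2 = 0 := cancel (i := 0) (j := 1) (k := 2) (by
    linear_combination μ 0 * h0 + μ 1 * h1 + μ 2 * h2 - 2 * μ 3 * h3)
  have t013 : τ 0 1 3 = 0 := cancel (i := 0) (j := 1) (k := 3) (by
    linear_combination μ 0 * h0 + μ 1 * h1 + μ 3 * h3 - 2 * μ 2 * h2)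
  have t023 : τ 0 2 3 = 0 := cancel (i := 0) (j := 2) (k := 3) (by
    linear_combination μ 0 * h0 + μ 2 * h2 + μ 3 * h3 - 2 * μ 1 * h1)
  have t123 : τ 1 2 3 = 0 := cancel (i := 1) (j := 2) (k := 3) (by
    linear_combination μ 1 * h1 + μ 2 * h2 + μ 3 * h3 - 2 * μ 0 * h0)
  clear h0 h1 h2 h3 h
  fin_cases a <;> fin_cases b <;> fin_cases c <;> simp only [Fin.reduceFinMk] <;> grind

theorem GeneralPosition.cubic_eq_zero [CharZero K] {q : Fin 6 → Fin 4 → K}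
    (hq : GeneralPosition q) {g : MvPolynomial (Fin 4) K} (hg : g.IsHomogeneous 3)
    (hs : ∀ j : Fin 6, j ≠ 5 → g ∈ singularAt (q j)) : g = 0 := by
  obtain ⟨L, hL, hd, hX, -⟩ := exists_dual_forms (hq ![0, 1, 2, 3] (by decide))
  set w : Fin 4 → Fin 4 → K := fun a => q (![0, 1, 2, 3] a) with hw
  let D : Fin 4 → MvPolynomial (Fin 4) K → MvPolynomial (Fin 4) K :=
    fun a f => ∑ i, w a i • pderiv i f
  have hDdeg : ∀ a n f, f.IsHomogeneous n → (D a f).IsHomogeneous (n - 1) := fun a n f hf =>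
    IsHomogeneous.sum _ _ _ fun i _ => by
      rw [smul_eq_C_mul]
      exact hf.pderiv.C_mul _
  have hcomm : ∀ a b f, D a (D b f) = D b (D a f) := by
    intro a b f
    simp only [D, map_sum, Derivation.map_smul, Finset.smul_sum]
    rw [Finset.sum_comm]
    refine Finset.sum_congr rfl fun i _ => Finset.sum_congr rfl fun j _ => ?_
    rw [smul_comm, pderiv_pderiv_comm]
  have hE : ∀ n f, f.IsHomogeneous n → ∑ a, L a * D a f = n • f := by
    intro n f hf
    rw [← hf.sum_X_mul_pderiv]
    simp only [D, Finset.mul_sum, hX, Finset.sum_mul]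
    rw [Finset.sum_comm]
    refine Finset.sum_congr rfl fun i _ => Finset.sum_congr rfl fun a _ => ?_
    rw [mul_smul_comm, smul_mul_assoc]
  have hE0 : ∀ n f, f.IsHomogeneous (n + 1) → (∀ a, D a f = 0) → f = 0 := by
    intro n f hf h
    have := hE _ f hf
    simpa [h, Nat.cast_add_one_ne_zero, eq_comm (a := (0 : MvPolynomial (Fin 4) K))] using this
  have hτ : ∀ a b c, ∃ t : K, D a (D b (D c g)) = C t := fun a b c => by
    have h := hDdeg a _ _ (hDdeg b _ _ (hDdeg c _ _ hg))
    rw [← totalDegree_zero_iff_isHomogeneous, totalDegree_eq_zero_iff_eq_C] at h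
    exact ⟨_, h⟩
  choose τ hτ using hτ
  have h12 : ∀ a b c, τ a b c = τ b a c := fun a b c =>
    C_injective (Fin 4) K (by rw [← hτ, ← hτ, hcomm])
  have h23 : ∀ a b c, τ a b c = τ a c b := fun a b c =>
    C_injective (Fin 4) K (by rw [← hτ, ← hτ, hcomm b c])
  have hsing : ∀ j : Fin 6, j ≠ 5 → ∀ c,
      ∑ a, ∑ b, eval (q j) (L a) * (eval (q j) (L b) * τ b a c) = 0 := by
    intro j hj c
    have h0 : eval (q j) (D c g) = 0 := by
      simp [D, smul_eval, (hs j hj).2]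
    have h2 := congrArg (eval (q j)) (hE _ _ (hDdeg c _ _ hg))
    rw [map_nsmul, h0, smul_zero, map_sum] at h2
    rw [← h2]
    refine Finset.sum_congr rfl fun a _ => ?_
    have h1 := congrArg (eval (q j)) (hE _ _ (hDdeg a _ _ (hDdeg c _ _ hg)))
    rw [map_nsmul, map_sum] at h1
    simp only [map_mul, hτ, eval_C, Nat.reduceSub, one_smul] at h1
    rw [map_mul, ← h1, Finset.mul_sum]
  have hdiag : ∀ s c, τ s s c = 0 := by
    intro s c
    have := hsing (![0, 1, 2, 3] s) (by revert s; decide) c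
    simpa [hd, ite_mul, Finset.sum_ite_eq'] using this
  have hμ : ∀ a, eval (q 4) (L a) ≠ 0 := by
    intro a
    refine hq.eval_dual_form_ne_zero (hL a) ?_ a fun b hb => ?_
    · intro h
      simpa [h] using hd a a
    · simpa [Ne.symm hb] using hd a b
  have h4 := hsing 4 (by decide)
  have hall := symmetric_trilinear_eq_zero h12 h23 hdiag hμ h4
  refine hE0 2 g hg fun c => hE0 1 _ (hDdeg c _ _ hg) fun b =>
    hE0 0 _ (hDdeg b _ _ (hDdeg c _ _ hg)) fun a => ?_
  rw [hτ, hall, map_zero]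

theorem eval_eq_zero_of_mem_pointIdeal {p : Fin 4 → K} {f : MvPolynomial (Fin 4) K}
    (hf : f ∈ pointIdeal K p) : eval p f = 0 := by
  have h : pointIdeal K p ≤ RingHom.ker (eval p) := Ideal.span_le.2 fun g hg => hg.2
  exact h hf

theorem pderiv_mem_pow {I : Ideal (MvPolynomial (Fin 4) K)} (i : Fin 4) (m : ℕ)
    {f : MvPolynomial (Fin 4) K} (hf : f ∈ I ^ (m + 1)) : pderiv i f ∈ I ^ m := by
  induction m generalizing f with
  | zero => simp
  | succ m ih =>
    rw [pow_succ] at hf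
    induction hf using Submodule.mul_induction_on' with
    | mem_mul_mem a ha b hb =>
      rw [pderiv_mul]
      exact Ideal.add_mem _ (pow_succ I m ▸ Ideal.mul_mem_mul (ih ha) hb)
        (Ideal.mul_mem_right _ _ ha)
    | add a _ b _ ha hb =>
      rw [map_add]
      exact Ideal.add_mem _ ha hb

theorem mem_singularAt_of_mem_sq {p : Fin 4 → K} {f : MvPolynomial (Fin 4) K}
    (hf : f ∈ pointIdeal K p ^ 2) : f ∈ singularAt p :=
  ⟨eval_eq_zero_of_mem_pointIdeal (Ideal.pow_le_self two_ne_zero hf), fun i =>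
    eval_eq_zero_of_mem_pointIdeal (by simpa using pderiv_mem_pow i 1 hf)⟩

attribute [local instance] MvPolynomial.gradedAlgebra

theorem pointIdeal_pow_isHomogeneous (p : Fin 4 → K) (m : ℕ) :
    (pointIdeal K p ^ m).IsHomogeneous (homogeneousSubmodule (Fin 4) K) := by
  have h1 : (pointIdeal K p).IsHomogeneous (homogeneousSubmodule (Fin 4) K) :=
    Ideal.homogeneous_span _ _ fun f hf => ⟨1, hf.1⟩
  induction m with
  | zero =>
    rw [pow_zero, Ideal.one_eq_top]
    exact Ideal.IsHomogeneous.top _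
  | succ m ih =>
    rw [pow_succ]
    exact ih.mul h1

theorem mem_pointIdeal_of_mem_formsOn {p : Fin 4 → K} (hp : p ≠ 0) {d : ℕ}
    {f : MvPolynomial (Fin 4) K} (hf : f ∈ formsOn (d + 1) {p}) : f ∈ pointIdeal K p := by
  obtain ⟨i, hi⟩ := Function.ne_iff.1 hp
  have hl : (p i)⁻¹ • X i ∈ formsOn 1 (∅ : Set (Fin 4 → K)) :=
    Submodule.smul_mem _ _ ⟨isHomogeneous_X _ _, by simp⟩
  have hlp : eval p ((p i)⁻¹ • X i) = 1 := by
    simpa [smul_eval] using inv_mul_cancel₀ hi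
  have h := pow_le_vanishing_mul_add hl hlp d
  rw [formsOn_one_empty_pow, formsOn_one_empty_pow] at h
  obtain ⟨g, hg, c, hc, rfl⟩ := Submodule.mem_sup.1 (h (formsOn_anti _ (Set.empty_subset _) hf))
  obtain ⟨a, rfl⟩ := Submodule.mem_span_singleton.1 hc
  have hg0 : eval p g = 0 := (formsOn_mul_le _ _ _ _ hg).2 p (by simp)
  have ha : a = 0 := by
    have := hf.2 p rfl
    rw [map_add, hg0, smul_eval, map_pow, hlp] at this
    simpa using this
  subst ha
  rw [zero_smul, add_zero]
  have hle : formsOn 1 {p} * formsOn d ∅ ≤ (pointIdeal K p).restrictScalars K :=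
    Submodule.mul_le.2 fun a ha b _ => Ideal.mul_mem_right _ _
      (Ideal.subset_span ⟨ha.1, ha.2 p rfl⟩)
  exact hle hg

theorem mul_le_restrictScalars_mul {V W : Submodule K (MvPolynomial (Fin 4) K)}
    {I J : Ideal (MvPolynomial (Fin 4) K)} (hV : V ≤ I.restrictScalars K)
    (hW : W ≤ J.restrictScalars K) : V * W ≤ (I * J).restrictScalars K :=
  Submodule.mul_le.2 fun _ ha _ hb => Ideal.mul_mem_mul (hV ha) (hW hb)

theorem formsOn_one_pow_mul_le (s : ℕ) {Q : Submodule K (MvPolynomial (Fin 4) K)}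
    {J : Ideal (MvPolynomial (Fin 4) K)} (hQ : Q ≤ J.restrictScalars K) :
    formsOn 1 (∅ : Set (Fin 4 → K)) ^ (s + 2) * (Q * Q) ≤
      (irrIdeal K ^ 2 * J ^ 2).restrictScalars K := by
  have hA : formsOn 1 (∅ : Set (Fin 4 → K)) ≤ (irrIdeal K).restrictScalars K := by
    rw [formsOn_empty, homogeneousSubmodule_one_eq_span_X]
    exact Submodule.span_le.2 Ideal.subset_span
  have hA2 : formsOn 1 (∅ : Set (Fin 4 → K)) ^ (s + 2) ≤ (irrIdeal K ^ 2).restrictScalars K := by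
    rw [pow_add, pow_two, pow_two (irrIdeal K)]
    have := mul_le_restrictScalars_mul (I := ⊤) (V := formsOn 1 (∅ : Set (Fin 4 → K)) ^ s)
      (fun _ _ => trivial) (mul_le_restrictScalars_mul hA hA)
    rwa [Ideal.top_mul] at this
  rw [pow_two J]
  exact mul_le_restrictScalars_mul hA2 (mul_le_restrictScalars_mul hQ hQ)

theorem eq_zero_of_pderiv_eq_zero [CharZero K] {d : ℕ} {f : MvPolynomial (Fin 4) K}
    (hf : f.IsHomogeneous (d + 1)) (h : ∀ i, pderiv i f = 0) : f = 0 := by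
  have := hf.sum_X_mul_pderiv
  simpa [h, Nat.cast_add_one_ne_zero, eq_comm (a := (0 : MvPolynomial (Fin 4) K))] using this

theorem GeneralPosition.eq_zero_of_degree_le_five [CharZero K] {q : Fin 6 → Fin 4 → K}
    (hq : GeneralPosition q) {d : ℕ} (hd : d ≤ 5) {f : MvPolynomial (Fin 4) K}
    (hf : f.IsHomogeneous d) (h : ∀ j : Fin 6, j ≠ 5 → f ∈ pointIdeal K (q j) ^ 4) : f = 0 := by
  have hg : (X 0 ^ (5 - d) * f).IsHomogeneous 5 := by
    have := (isHomogeneous_X_pow (R := K) (0 : Fin 4) (5 - d)).mul hf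
    rwa [Nat.sub_add_cancel hd] at this
  have hg0 : X 0 ^ (5 - d) * f = 0 := by
    refine eq_zero_of_pderiv_eq_zero hg fun i =>
      eq_zero_of_pderiv_eq_zero (d := 3) hg.pderiv fun k =>
      hq.cubic_eq_zero (hg.pderiv.pderiv) fun j hj => mem_singularAt_of_mem_sq ?_
    exact pderiv_mem_pow _ _ (pderiv_mem_pow _ _ (Ideal.mul_mem_left _ _ (h j hj)))
  exact (mul_eq_zero.1 hg0).resolve_left (pow_ne_zero _ (X_ne_zero _))

theorem GeneralPosition.iInf_pow_four_le [CharZero K] {q : Fin 6 → Fin 4 → K}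
    (hq : GeneralPosition q) (S : Finset (Fin 6)) (hS : ∀ j, j ≠ 5 → j ∈ S)
    (h0 : ∀ j ∈ S, q j ≠ 0) :
    (⨅ j ∈ S, pointIdeal K (q j) ^ 4) ≤ irrIdeal K ^ 2 * (⨅ j ∈ S, pointIdeal K (q j)) ^ 2 := by
  intro f hf
  have hhom : (⨅ j ∈ S, pointIdeal K (q j) ^ 4).IsHomogeneous (homogeneousSubmodule (Fin 4) K) :=
    Ideal.IsHomogeneous.iInf₂ fun j _ => pointIdeal_pow_isHomogeneous (q j) 4
  rw [← sum_homogeneousComponent f]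
  refine Ideal.sum_mem _ fun d _ => ?_
  have hd := homogeneousComponent_mem_of_mem hhom hf d
  have hdeg := homogeneousComponent_isHomogeneous d f
  generalize homogeneousComponent d f = g at hd hdeg
  simp only [Submodule.mem_iInf] at hd
  rcases le_or_gt d 5 with h5 | h5
  · rw [hq.eq_zero_of_degree_le_five h5 hdeg fun j hj => hd j (hS j hj)]
    exact Ideal.zero_mem _
  · obtain ⟨s, rfl⟩ : ∃ s, d = s + 6 := ⟨d - 6, by omega⟩
    have hg := hq.mem_sq_of_singularAt s hdeg S fun j hj =>
      mem_singularAt_of_mem_sq (Ideal.pow_le_pow_right (by norm_num) (hd j hj))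
    refine formsOn_one_pow_mul_le s (fun x hx => ?_) hg
    simp only [Submodule.restrictScalars_mem, Submodule.mem_iInf]
    exact fun j hj => mem_pointIdeal_of_mem_formsOn (h0 j hj) (d := 1)
      (formsOn_anti 2 (Set.singleton_subset_iff.2 (Set.mem_image_of_mem q hj)) hx)

/-- Extend `n ≤ 6` vectors to six by points of the moment curve. -/
def extendByCurve {R : Type} [CommSemiring R] {n : ℕ} (v : Fin n → Fin 4 → R) :
    Fin 6 → Fin 4 → R :=
  fun j i => if h : j.val < n then v ⟨j.val, h⟩ i else (j.val : R) ^ i.val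

/-- The product of all maximal minors of the extension of `n` generic vectors. -/
def genericityPoly (K : Type) [Field K] (n : ℕ) : MvPolynomial (Fin n × Fin 4) K :=
  ∏ σ : Fin 4 ↪ Fin 6, (Matrix.of fun a i => extendByCurve (fun j i => X (j, i)) (σ a) i).det

theorem eval_genericityPoly {n : ℕ} (v : Fin n → Fin 4 → K) :
    eval (fun p => v p.1 p.2) (genericityPoly K n) =
      ∏ σ : Fin 4 ↪ Fin 6, (Matrix.of fun a => extendByCurve v (σ a)).det := by
  rw [genericityPoly, map_prod]
  refine Finset.prod_congr rfl fun σ _ => ?_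
  rw [RingHom.map_det]
  congr 1
  ext a i
  simp only [RingHom.mapMatrix_apply, Matrix.map_apply, Matrix.of_apply, extendByCurve]
  split <;> simp

theorem genericityPoly_ne_zero [CharZero K] (n : ℕ) : genericityPoly K n ≠ 0 := by
  intro h
  have h1 := eval_genericityPoly (K := K) (n := n) fun j i => (j.val : K) ^ i.val
  rw [h, map_zero, eq_comm, Finset.prod_eq_zero_iff] at h1
  obtain ⟨σ, -, hσ⟩ := h1
  have h2 : (Matrix.of fun a => extendByCurve (fun (j : Fin n) (i : Fin 4) =>
      (j.val : K) ^ i.val) (σ a)) = Matrix.vandermonde fun a => ((σ a).val : K) := by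
    ext a i
    simp [extendByCurve, Matrix.vandermonde_apply]
  rw [h2] at hσ
  refine Matrix.det_vandermonde_ne_zero_iff.2 (fun a b hab => ?_) hσ
  exact σ.injective (Fin.ext (Nat.cast_injective hab))

theorem generalPosition_extendByCurve {n : ℕ} {v : Fin n → Fin 4 → K}
    (h : eval (fun p => v p.1 p.2) (genericityPoly K n) ≠ 0) :
    GeneralPosition (extendByCurve v) := by
  rw [eval_genericityPoly, Finset.prod_ne_zero_iff] at h
  exact fun σ hσ => h ⟨σ, hσ⟩ (Finset.mem_univ _)

end Forms

/-- For `n ∈ {5,6}` points in general position in `ℙ³`: `I^(4) ⊆ M²·I²`. -/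
theorem five_six_points_containment (K : Type) [Field K] [CharZero K] (n : ℕ)
    (hn : n = 5 ∨ n = 6) :
    ∃ G : MvPolynomial (Fin n × Fin 4) K, G ≠ 0 ∧
      ∀ v : Fin n → Fin 4 → K, (∀ j, v j ≠ 0) →
        eval (fun p => v p.1 p.2) G ≠ 0 →
        (⨅ j, pointIdeal K (v j) ^ 4) ≤ irrIdeal K ^ 2 * (⨅ j, pointIdeal K (v j)) ^ 2 := by
  refine ⟨genericityPoly K n, genericityPoly_ne_zero n, fun v hv hG => ?_⟩
  have hext : ∀ (j : Fin 6) (h : j.val < n), extendByCurve v j = v ⟨j.val, h⟩ := fun j h => by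
    ext i
    simp [extendByCurve, h]
  have hinf : ∀ m : ℕ, (⨅ j ∈ Finset.univ.filter fun j : Fin 6 => j.val < n,
      pointIdeal K (extendByCurve v j) ^ m) = ⨅ j, pointIdeal K (v j) ^ m := by
    intro m
    refine le_antisymm (le_iInf fun j => ?_) (le_iInf₂ fun j hj => ?_)
    · have hj : j.val < 6 := by omega
      have h := hext ⟨j.val, hj⟩ j.isLt
      rw [Fin.eta] at h
      rw [← h]
      exact iInf₂_le _ (by simp)
    · have hj' : j.val < n := by simpa using hj
      rw [hext j hj']
      exact iInf_le _ _
  have h1 := hinf 1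
  simp only [pow_one] at h1
  rw [← hinf 4, ← h1]
  refine (generalPosition_extendByCurve hG).iInf_pow_four_le _ (fun j hj => ?_) fun j hj => ?_
  · simp only [Finset.mem_filter, Finset.mem_univ, true_and]
    omega
  · have hj' : j.val < n := by simpa using hj
    rw [hext j hj']
    exact hv _

end
end

section
/- Let K be a field of characteristic zero, R = K[x_0,x_1,x_2,x_3], and let 1 ≤ n ≤ 4. Let e_1,…,e_n be among the standard basis vectors of K^4, so that m_{e_j} is the ideal of R generated by the three variables x_i with i ≠ j−1, and set I = ⋂_{j=1}^n m_{e_j} and I^{(m)} = ⋂_{j=1}^n m_{e_j}^m. Then I^{(3r−2)} ⊆ M^{2r−2}·I^r for every integer r ≥ 1. -/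
open MvPolynomial Filter

noncomputable section

/-- The vanishing ideal of the coordinate point `e_j` of `ℙ³`: the ideal generated by
the three variables `xᵢ` with `i ≠ j`. -/
def coordIdeal4 (K : Type) [Field K] (j : Fin 4) : Ideal (MvPolynomial (Fin 4) K) :=
  Ideal.span {f | ∃ i, i ≠ j ∧ f = X i}

/-- Every monomial of a polynomial in the `m`-th power of the ideal of a coordinate point has
degree at least `m` in the variables other than the `j`-th. -/
lemma le_degree_sub_of_mem_coordIdeal4_pow {K : Type} [Field K] (j : Fin 4) (m : ℕ) :
    ∀ f ∈ coordIdeal4 K j ^ m, ∀ a ∈ f.support, a j + m ≤ a.degree := by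
  induction m with
  | zero => exact fun f _ a _ => by simpa using Finsupp.le_degree j a
  | succ m ih =>
    intro f hf
    rw [pow_succ'] at hf
    refine Submodule.mul_induction_on hf ?_ ?_
    · intro g hg f hf
      induction hg using Submodule.span_induction generalizing f with
      | mem g hg =>
        obtain ⟨i, hij, rfl⟩ := hg
        intro a ha
        rw [support_X_mul, Finset.mem_map] at ha
        obtain ⟨b, hb, rfl⟩ := ha
        have := ih f hf b hb
        simp [map_add, hij] at this ⊢
        omega
      | zero => simp
      | add x y _ _ hx hy =>
        intro a ha
        rw [add_mul] at ha
        rcases Finset.mem_union.1 (support_add ha) with h | h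
        exacts [hx f hf a h, hy f hf a h]
      | smul p x _ hx =>
        intro a ha
        rw [smul_eq_mul, mul_comm p, mul_assoc] at ha
        exact hx (p * f) (Ideal.mul_mem_left _ _ hf) a ha
    · intro x y hx hy a ha
      rcases Finset.mem_union.1 (support_add ha) with h | h
      exacts [hx a h, hy a h]

lemma monomial_mem_irrIdeal_pow {K : Type} [Field K] (t : ℕ) (a : Fin 4 →₀ ℕ)
    (h : t ≤ a.degree) : monomial a (1 : K) ∈ irrIdeal K ^ t := by
  have hX (i : Fin 4) : (X i : MvPolynomial (Fin 4) K) ∈ irrIdeal K :=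
    Ideal.subset_span ⟨i, rfl⟩
  refine Ideal.pow_le_pow_right h ?_
  rw [monomial_eq, C_1, one_mul, Finsupp.degree_eq_sum, Finsupp.prod_fintype _ _ (by simp),
    ← Finset.prod_pow_eq_pow_sum]
  exact Ideal.prod_mem_prod fun i _ => Ideal.pow_mem_pow (hX i) _

/-- Among the exponents of a monomial there are two that dominate all the others. -/
lemma exists_two_largest (a : Fin 4 → ℕ) :
    ∃ i j, i ≠ j ∧ a j ≤ a i ∧ ∀ k, k ≠ i → a k ≤ a j := by
  obtain ⟨i, -, hi⟩ := Finset.exists_max_image Finset.univ a ⟨0, Finset.mem_univ _⟩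
  obtain ⟨j, hj, hj'⟩ := Finset.exists_max_image (Finset.univ.erase i) a
    (Finset.card_pos.1 (by simp))
  exact ⟨i, j, (Finset.ne_of_mem_erase hj).symm, hi j (Finset.mem_univ _),
    fun k hk => hj' k (by simp [hk])⟩

/-- A monomial lies in `M ^ t * I ^ r` under linear conditions on its exponents, where `I` contains
the variables outside `S` and all products of two distinct variables. -/
lemma monomial_mem_irrIdeal_pow_mul_pow {K : Type} [Field K] (S : Finset (Fin 4))
    (I : Ideal (MvPolynomial (Fin 4) K)) (hX : ∀ i ∉ S, X i ∈ I)
    (hXX : ∀ i j, i ≠ j → X i * X j ∈ I) (t r : ℕ) (a : Fin 4 →₀ ℕ)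
    (ha : ∀ j ∈ S, a j + r ≤ a.degree) (hd : t + r ≤ a.degree)
    (hb : t + 2 * r ≤ a.degree + ∑ i ∈ Sᶜ, a i) :
    monomial a (1 : K) ∈ irrIdeal K ^ t * I ^ r := by
  induction r generalizing a with
  | zero => simpa using monomial_mem_irrIdeal_pow t a (by omega)
  | succ r ih =>
    by_cases h0 : ∑ i ∈ Sᶜ, a i = 0
    · rw [h0] at hb
      obtain ⟨i, j, hij, hji, hk⟩ := exists_two_largest a
      have hS (k : Fin 4) (hk : a k ≠ 0) : k ∈ S := by
        by_contra h
        exact hk (Finset.sum_eq_zero_iff.1 h0 k (by simpa using h))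
      have hdeg : a.degree = a 0 + a 1 + a 2 + a 3 := by
        rw [Finsupp.degree_eq_sum, Fin.sum_univ_four]
      have hi0 : a i ≠ 0 := by
        intro h
        have (k : Fin 4) : a k = 0 := by
          by_cases hki : k = i
          · rw [hki, h]
          · have := hk k hki; omega
        simp only [this] at hdeg
        omega
      have hj0 : a j ≠ 0 := by
        intro h
        have hz (k : Fin 4) (hki : k ≠ i) : a k = 0 := by have := hk k hki; omega
        have hs : a.degree = a i := by
          rw [Finsupp.degree_eq_sum]
          exact Finset.sum_eq_single i (fun k _ => hz k) (by simp)
        have := ha i (hS i hi0)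
        omega
      obtain ⟨b, rfl⟩ : ∃ b, a = Finsupp.single i 1 + Finsupp.single j 1 + b := by
        refine exists_add_of_le fun k => ?_
        simp only [Finsupp.add_apply, Finsupp.single_apply]
        split_ifs with h1 h2 h2 <;> subst_vars <;> omega
      have hdb : (Finsupp.single i 1 + Finsupp.single j 1 + b).degree = b.degree + 2 := by
        simp [map_add]; omega
      have hmem := ih b (fun k hkS => ?_) (by omega) (by omega)
      · have hm : monomial (Finsupp.single i 1 + Finsupp.single j 1 + b) (1 : K)
            = monomial b 1 * (X i * X j) := by
          simp [X, monomial_mul, add_comm]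
        rw [hm, pow_succ, ← mul_assoc]
        exact Ideal.mul_mem_mul hmem (hXX i j hij)
      · have hak := ha k hkS
        by_cases hki : k = i
        · subst hki
          simp [hij] at hak hdb
          omega
        by_cases hkj : k = j
        · subst hkj
          simp [hij] at hak hdb
          omega
        have hsum : b i + b j + b k ≤ b.degree := by
          have h : ∑ x ∈ {i, j, k}, b x ≤ ∑ x, b x :=
            Finset.sum_le_sum_of_subset (Finset.subset_univ _)
          rw [← Finsupp.degree_eq_sum] at h
          rw [Finset.sum_insert (by simp [hij, Ne.symm hki]),
            Finset.sum_insert (by simp [Ne.symm hkj]), Finset.sum_singleton] at h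
          omega
        have hkk := hk k hki
        rw [hdb] at hak hb
        simp [hij, hij.symm, Ne.symm hki, Ne.symm hkj] at hak hkk hji
        omega
    · obtain ⟨i, hi, hi0⟩ := Finset.exists_ne_zero_of_sum_ne_zero h0
      obtain ⟨b, rfl⟩ : ∃ b, a = Finsupp.single i 1 + b := by
        refine exists_add_of_le fun k => ?_
        simp only [Finsupp.single_apply]
        split_ifs with h1 <;> subst_vars <;> omega
      have hiS : i ∉ S := by simpa using hi
      have hdb : (Finsupp.single i 1 + b).degree = b.degree + 1 := by
        simp [map_add]; omega
      have hbb : ∑ k ∈ Sᶜ, (Finsupp.single i 1 + b : Fin 4 →₀ ℕ) k = ∑ k ∈ Sᶜ, b k + 1 := by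
        simp [Finset.sum_add_distrib, Finsupp.single_apply, hiS]; omega
      have hmem := ih b (fun k hkS => ?_) (by omega) (by omega)
      · have hm : monomial (Finsupp.single i 1 + b) (1 : K) = monomial b 1 * X i := by
          simp [X, monomial_mul, add_comm]
        rw [hm, pow_succ, ← mul_assoc]
        exact Ideal.mul_mem_mul hmem (hX i hiS)
      · have := ha k hkS
        have hik : i ≠ k := fun h => hiS (h ▸ hkS)
        rw [hdb] at this
        simp [hik] at this
        omega

lemma X_mem_coordIdeal4 {K : Type} [Field K] {i j : Fin 4} (h : i ≠ j) :
    X i ∈ coordIdeal4 K j :=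
  Ideal.subset_span ⟨i, h, rfl⟩

/-- For the ideal `I` of `n ≤ 4` coordinate points of `ℙ³`:
`I^(3r-2) ⊆ M^(2r-2)·I^r` for every `r ≥ 1`. -/
theorem coordinate_points_containment (K : Type) [Field K] [CharZero K] (n : ℕ)
    (h1 : 1 ≤ n) (h4 : n ≤ 4) (r : ℕ) (hr : 1 ≤ r) :
    (⨅ j : Fin n, coordIdeal4 K (Fin.castLE h4 j) ^ (3 * r - 2)) ≤
      irrIdeal K ^ (2 * r - 2) * (⨅ j : Fin n, coordIdeal4 K (Fin.castLE h4 j)) ^ r := by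
  intro f hf
  rw [Submodule.mem_iInf] at hf
  rw [f.as_sum]
  refine Ideal.sum_mem _ fun a ha => ?_
  rw [← mul_one (coeff a f), ← C_mul_monomial]
  refine Ideal.mul_mem_left _ _ ?_
  have key (j : Fin 4) (hj : (j : ℕ) < n) : a j + (3 * r - 2) ≤ a.degree :=
    le_degree_sub_of_mem_coordIdeal4_pow j _ f (hf ⟨j, hj⟩) a ha
  have hdeg : a.degree = a 0 + a 1 + a 2 + a 3 := by
    rw [Finsupp.degree_eq_sum, Fin.sum_univ_four]
  refine monomial_mem_irrIdeal_pow_mul_pow (Finset.univ.filter fun j : Fin 4 => (j : ℕ) < n) _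
    (fun i hi => ?_) (fun i j hij => ?_) _ r a (fun j hj => ?_) ?_ ?_
  · rw [Submodule.mem_iInf]
    refine fun j => X_mem_coordIdeal4 fun h => hi ?_
    simp [h]
  · rw [Submodule.mem_iInf]
    intro k
    by_cases hik : i = Fin.castLE h4 k
    · exact Ideal.mul_mem_left _ _ (X_mem_coordIdeal4 fun h => hij (hik.trans h.symm))
    · exact Ideal.mul_mem_right _ _ (X_mem_coordIdeal4 hik)
  · have := key j (by simpa using hj)
    omega
  · have := key 0 h1
    omega
  · rw [Finset.compl_filter, Finset.sum_filter, Fin.sum_univ_four, hdeg]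
    have k0 := key 0
    have k1 := key 1
    have k2 := key 2
    have k3 := key 3
    rw [hdeg] at k0 k1 k2 k3
    interval_cases n <;> simp at k0 k1 k2 k3 ⊢ <;> omega

end
end
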